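/- arXiv:1009.2990 — 4 statements merged into one kernel-verified Lean document; each statement's English description precedes it below -/
import Mathlib

section
/- (Variance of the degree distribution.) For every N ≥ 1: if N is even then Var_{μ_N}(a) = N(N−1)(2N+5)/96, and if N is odd then Var_{μ_N}(b) = N(N−1)(2N+5)/96. -/
/-- The image of the delta measure at `p` under the Demazure operator `D₀`, acting in the
coordinates `λ = Λ₀ - a·α₀ - b·α₁`: `D₀ δ_{(a,b)} = ∑_{i=0}^{1-2a+2b} δ_{(a+i,b)}`, with the
signed-sum convention `∑_{i=0}^{-1} = 0` and `∑_{i=0}^{n} = -∑_{i=n+1}^{-1}` for `n ≤ -2`. -/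
noncomputable def elemD0 (p : ℤ × ℤ) : (ℤ × ℤ) →₀ ℤ :=
  (∑ i ∈ Finset.Icc (0 : ℤ) (1 - 2 * p.1 + 2 * p.2), Finsupp.single (p.1 + i, p.2) (1 : ℤ))
  - (∑ i ∈ Finset.Icc (1 - 2 * p.1 + 2 * p.2 + 1) (-1 : ℤ), Finsupp.single (p.1 + i, p.2) (1 : ℤ))

/-- The image of the delta measure at `p` under the Demazure operator `D₁`:
`D₁ δ_{(a,b)} = ∑_{i=0}^{2a-2b} δ_{(a,b+i)}`, with the signed-sum convention. -/
noncomputable def elemD1 (p : ℤ × ℤ) : (ℤ × ℤ) →₀ ℤ :=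
  (∑ i ∈ Finset.Icc (0 : ℤ) (2 * p.1 - 2 * p.2), Finsupp.single (p.1, p.2 + i) (1 : ℤ))
  - (∑ i ∈ Finset.Icc (2 * p.1 - 2 * p.2 + 1) (-1 : ℤ), Finsupp.single (p.1, p.2 + i) (1 : ℤ))

/-- The Demazure operator `D₀` on finitely supported functions `ℤ × ℤ → ℤ`. -/
noncomputable def demD0 (mu : (ℤ × ℤ) →₀ ℤ) : (ℤ × ℤ) →₀ ℤ :=
  mu.sum fun p c => c • elemD0 p

/-- The Demazure operator `D₁` on finitely supported functions `ℤ × ℤ → ℤ`. -/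
noncomputable def demD1 (mu : (ℤ × ℤ) →₀ ℤ) : (ℤ × ℤ) →₀ ℤ :=
  mu.sum fun p c => c • elemD1 p

/-- The weight distribution `μ_N` of the Demazure module `V_{w_N}(Λ₀)` of affine sl₂,
where a weight is written `λ = Λ₀ - a·α₀ - b·α₁`:  `μ₀ = δ_{(0,0)}`,
`μ_{N+1} = D₀ μ_N` for even `N` and `μ_{N+1} = D₁ μ_N` for odd `N`. -/
noncomputable def demMu : ℕ → (ℤ × ℤ) →₀ ℤ
  | 0 => Finsupp.single (0, 0) 1
  | (N + 1) => if Even N then demD0 (demMu N) else demD1 (demMu N)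

/-- Total mass `∑_{(a,b)} μ(a,b)` of a finitely supported signed measure, in `ℚ`. -/
noncomputable def totalMass (mu : (ℤ × ℤ) →₀ ℤ) : ℚ :=
  mu.sum fun _ c => (c : ℚ)

/-- Expected value of `f` with respect to `μ`. -/
noncomputable def expVal (mu : (ℤ × ℤ) →₀ ℤ) (f : ℤ × ℤ → ℚ) : ℚ :=
  (mu.sum fun p c => (c : ℚ) * f p) / totalMass mu

/-- Covariance of `f` and `g` with respect to `μ`. -/
noncomputable def covar (mu : (ℤ × ℤ) →₀ ℤ) (f g : ℤ × ℤ → ℚ) : ℚ :=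
  expVal mu (fun p => f p * g p) - expVal mu f * expVal mu g

/-- Variance of `f` with respect to `μ`. -/
noncomputable def var (mu : (ℤ × ℤ) →₀ ℤ) (f : ℤ × ℤ → ℚ) : ℚ :=
  covar mu f f

/-- The integral of `f` against the signed measure `mu`. -/
noncomputable def integral (mu : (ℤ × ℤ) →₀ ℤ) (f : ℤ × ℤ → ℚ) : ℚ :=
  mu.sum fun p c => (c : ℚ) * f p

theorem integral_single (p : ℤ × ℤ) (c : ℤ) (f : ℤ × ℤ → ℚ) :
    integral (Finsupp.single p c) f = c * f p := by
  simp [integral]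

theorem integral_add (mu nu : (ℤ × ℤ) →₀ ℤ) (f : ℤ × ℤ → ℚ) :
    integral (mu + nu) f = integral mu f + integral nu f :=
  Finsupp.sum_add_index' (by simp) (by intros; push_cast; ring)

/-- `integral · f` as an additive homomorphism. -/
noncomputable def integralHom (f : ℤ × ℤ → ℚ) : ((ℤ × ℤ) →₀ ℤ) →+ ℚ where
  toFun mu := integral mu f
  map_zero' := by simp [integral]
  map_add' mu nu := integral_add mu nu f

@[simp]
theorem integralHom_apply (f : ℤ × ℤ → ℚ) (mu : (ℤ × ℤ) →₀ ℤ) :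
    integralHom f mu = integral mu f := rfl

/-- Integrating against the image of `mu` under the linear extension of a kernel `e`. -/
theorem integral_sum_smul (mu : (ℤ × ℤ) →₀ ℤ) (e : ℤ × ℤ → (ℤ × ℤ) →₀ ℤ) (f : ℤ × ℤ → ℚ) :
    integral (mu.sum fun p c => c • e p) f = integral mu fun p => integral (e p) f := by
  rw [← integralHom_apply, map_finsuppSum]
  simp only [map_zsmul, integralHom_apply, zsmul_eq_mul]
  rfl

/-- Telescoping for signed sums: if `Φ` is an antiderivative of `f`, then the signed sum
`∑_{i=0}^{n} f i` equals `Φ (n + 1) - Φ 0` for every integer `n`. -/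
theorem signed_sum_eq_sub {f Φ : ℤ → ℚ} (h : ∀ i, Φ (i + 1) - Φ i = f i) (n : ℤ) :
    ∑ i ∈ Finset.Icc 0 n, f i - ∑ i ∈ Finset.Icc (n + 1) (-1), f i = Φ (n + 1) - Φ 0 := by
  have key : ∀ (a : ℤ) (k : ℕ), ∑ i ∈ Finset.Ico a (a + k), f i = Φ (a + k) - Φ a := by
    intro a k
    induction k with
    | zero => simp
    | succ k ih =>
      have hIco : Finset.Ico a (a + (k + 1 : ℕ)) = insert (a + k) (Finset.Ico a (a + k)) := by
        ext x; simp only [Finset.mem_Ico, Finset.mem_insert]; omega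
      rw [hIco, Finset.sum_insert (by simp), ih, ← h]
      push_cast
      rw [← add_assoc]
      ring
  have hpos : Finset.Icc 0 n = Finset.Ico 0 (n + 1) := by
    ext x; simp only [Finset.mem_Icc, Finset.mem_Ico]; omega
  have hneg : Finset.Icc (n + 1) (-1) = Finset.Ico (n + 1) 0 := by
    ext x; simp only [Finset.mem_Icc, Finset.mem_Ico]; omega
  rw [hpos, hneg]
  rcases le_total 0 (n + 1) with hn | hn
  · obtain ⟨k, hk⟩ := Int.eq_ofNat_of_zero_le hn
    have := key 0 k
    rw [zero_add, ← hk] at this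
    rw [this, Finset.Ico_eq_empty_of_le hn]
    simp
  · obtain ⟨k, hk⟩ := Int.eq_ofNat_of_zero_le (neg_nonneg.mpr hn)
    have := key (n + 1) k
    rw [← hk, add_neg_cancel] at this
    rw [this, Finset.Ico_eq_empty_of_le hn]
    simp

theorem integral_elemD0 (p : ℤ × ℤ) (f : ℤ × ℤ → ℚ) :
    integral (elemD0 p) f =
      ∑ i ∈ Finset.Icc (0 : ℤ) (1 - 2 * p.1 + 2 * p.2), f (p.1 + i, p.2)
      - ∑ i ∈ Finset.Icc (1 - 2 * p.1 + 2 * p.2 + 1) (-1 : ℤ), f (p.1 + i, p.2) := by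
  rw [← integralHom_apply, elemD0, map_sub, map_sum, map_sum]
  simp [integral_single]

theorem integral_elemD1 (p : ℤ × ℤ) (f : ℤ × ℤ → ℚ) :
    integral (elemD1 p) f =
      ∑ i ∈ Finset.Icc (0 : ℤ) (2 * p.1 - 2 * p.2), f (p.1, p.2 + i)
      - ∑ i ∈ Finset.Icc (2 * p.1 - 2 * p.2 + 1) (-1 : ℤ), f (p.1, p.2 + i) := by
  rw [← integralHom_apply, elemD1, map_sub, map_sum, map_sum]
  simp [integral_single]

/-- The coordinate preserved by the last Demazure operator applied to obtain `demMu N`, shifted so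
that both parities of `N` obey the same recursion. -/
def fixedCoord (N : ℕ) (p : ℤ × ℤ) : ℚ :=
  if Even N then (p.1 : ℚ) - N / 4 else (p.2 : ℚ) - (N - 1) / 4

/-- The coordinate along the strings of the last Demazure operator applied to obtain `demMu N`,
centred at the fixed point of the corresponding reflection. -/
def stringCoord (N : ℕ) (p : ℤ × ℤ) : ℚ :=
  if Even N then (p.1 : ℚ) - p.2 else 1 / 2 - ((p.1 : ℚ) - p.2)

/-- The integral against `demMu N` of a function of `fixedCoord N` and `stringCoord N`. -/
noncomputable def coordIntegral (N : ℕ) (g : ℚ → ℚ → ℚ) : ℚ :=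
  integral (demMu N) fun p => g (fixedCoord N p) (stringCoord N p)

/-- One Demazure step in the coordinates `fixedCoord` and `stringCoord`. -/
theorem coordIntegral_succ (N : ℕ) {g Φ : ℚ → ℚ → ℚ}
    (h : ∀ c u, Φ c u - Φ c (u - 1) = g c u) :
    coordIntegral (N + 1) g =
      coordIntegral N fun c s => Φ (c - s) (1 / 2 - s) - Φ (c - s) (s - 3 / 2) := by
  unfold coordIntegral
  by_cases hN : Even N
  · have hN' : ¬ Even (N + 1) := by simpa [Nat.even_add_one] using hN
    simp only [demMu, if_pos hN, demD0, integral_sum_smul, integral_elemD0]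
    congr 1
    funext p
    rw [signed_sum_eq_sub
      (Φ := fun i => -Φ (fixedCoord N p - stringCoord N p) (1 / 2 - stringCoord N p - i))]
    · simp only [fixedCoord, stringCoord, if_pos hN]
      push_cast
      ring_nf
    · intro i
      simp only [fixedCoord, stringCoord, if_pos hN, if_neg hN']
      rw [← h]
      push_cast
      ring_nf
  · have hN' : Even (N + 1) := by simpa [Nat.even_add_one] using hN
    simp only [demMu, if_neg hN, demD1, integral_sum_smul, integral_elemD1]
    congr 1
    funext p
    rw [signed_sum_eq_sub
      (Φ := fun i => -Φ (fixedCoord N p - stringCoord N p) (1 / 2 - stringCoord N p - i))]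
    · simp only [fixedCoord, stringCoord, if_neg hN]
      push_cast
      ring_nf
    · intro i
      simp only [fixedCoord, stringCoord, if_neg hN, if_pos hN']
      rw [← h]
      push_cast
      ring_nf

/-- The moments of `demMu N` in the coordinates `fixedCoord` and `stringCoord`, on a space of
polynomials for which the recursion `coordIntegral_succ` closes up. -/
theorem coordIntegral_polynomial (N : ℕ) : ∀ k0 k1 k2 k3 k4 k5 k6 k7 k8 k9 k10 k11 : ℚ,
    coordIntegral N (fun c s => k0 + k1 * s + k2 * s ^ 2 + k3 * s ^ 3 + k4 * s ^ 4 + k5 * s ^ 5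
      + c * (k6 + k7 * s + k8 * s ^ 2 + k9 * s ^ 3) + c ^ 2 * (k10 + k11 * s)) =
    2 ^ N * (k0 + k2 * (N / 4) + k4 * (3 * N ^ 2 / 16 - N / 8) + k6 * (N ^ 2 / 8 - N / 8)
      + k8 * (N ^ 3 / 32 + N ^ 2 / 32 - N / 16)
      + k10 * (N ^ 4 / 64 - N ^ 3 / 96 + 3 * N ^ 2 / 64 - 5 * N / 96)) := by
  induction N with
  | zero =>
    intros
    simp [coordIntegral, demMu, integral_single, fixedCoord, stringCoord]
  | succ N ih =>
    intro k0 k1 k2 k3 k4 k5 k6 k7 k8 k9 k10 k11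
    rw [coordIntegral_succ N (Φ := fun c u =>
      (k0 + c * k6 + c ^ 2 * k10) * u
      + (k1 + c * k7 + c ^ 2 * k11) * (u * (u + 1) / 2)
      + (k2 + c * k8) * (u * (u + 1) * (2 * u + 1) / 6)
      + (k3 + c * k9) * (u ^ 2 * (u + 1) ^ 2 / 4)
      + k4 * (u * (u + 1) * (2 * u + 1) * (3 * u ^ 2 + 3 * u - 1) / 30)
      + k5 * (u ^ 2 * (u + 1) ^ 2 * (2 * u ^ 2 + 2 * u - 1) / 12)) (by intros; ring)]
    have step := ih
      (2 * k0 + 1 / 2 * k2 + 1 / 8 * k4)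
      (-2 * k0 - 11 / 6 * k2 - 127 / 120 * k4 - 2 * k6 - 1 / 2 * k8)
      (2 * k2 + 3 * k4 + 2 * k6 + 11 / 6 * k8 + 2 * k10)
      (-2 / 3 * k2 - 11 / 3 * k4 - 2 * k8 - 2 * k10)
      (2 * k4 + 2 / 3 * k8)
      (-2 / 5 * k4)
      (2 * k6 + 1 / 2 * k8)
      (-2 * k6 - 11 / 6 * k8 - 4 * k10)
      (2 * k8 + 4 * k10)
      (-2 / 3 * k8)
      (2 * k10)
      (-2 * k10)
    convert step using 1
    · congr 1
      funext c s
      ring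
    · push_cast
      ring

theorem totalMass_demMu (N : ℕ) : totalMass (demMu N) = 2 ^ N := by
  have h := coordIntegral_polynomial N 1 0 0 0 0 0 0 0 0 0 0 0
  simpa [coordIntegral, integral, totalMass] using h

/-- The expectation of a quadratic polynomial in `fixedCoord`. -/
theorem expVal_fixedCoord (N : ℕ) {f : ℤ × ℤ → ℚ} (x y z : ℚ)
    (hf : ∀ p, f p = x + y * fixedCoord N p + z * fixedCoord N p ^ 2) :
    expVal (demMu N) f = x + y * (N ^ 2 / 8 - N / 8)
      + z * (N ^ 4 / 64 - N ^ 3 / 96 + 3 * N ^ 2 / 64 - 5 * N / 96) := by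
  have h := coordIntegral_polynomial N x 0 0 0 0 0 y 0 0 0 z 0
  have hint : integral (demMu N) f = coordIntegral N fun c s =>
      x + 0 * s + 0 * s ^ 2 + 0 * s ^ 3 + 0 * s ^ 4 + 0 * s ^ 5
      + c * (y + 0 * s + 0 * s ^ 2 + 0 * s ^ 3) + c ^ 2 * (z + 0 * s) := by
    unfold coordIntegral
    congr 1
    funext p
    rw [hf]
    ring
  change integral (demMu N) f / _ = _
  rw [totalMass_demMu, hint, h, mul_div_cancel_left₀ _ (by positivity)]
  ring

/-- The variance of any translate of `fixedCoord`. -/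
theorem var_fixedCoord (N : ℕ) {f : ℤ × ℤ → ℚ} (t : ℚ) (hf : ∀ p, f p = fixedCoord N p + t) :
    var (demMu N) f = (N : ℚ) * ((N : ℚ) - 1) * (2 * (N : ℚ) + 5) / 96 := by
  unfold var covar
  rw [expVal_fixedCoord N (t ^ 2) (2 * t) 1 (by intro p; rw [hf]; ring),
    expVal_fixedCoord N t 1 0 (by intro p; rw [hf]; ring)]
  ring

/-- Variance of the degree distribution: for `N ≥ 1`, if `N` is even then
`Var_{μ_N}(a) = N(N-1)(2N+5)/96`, and if `N` is odd then `Var_{μ_N}(b) = N(N-1)(2N+5)/96`. -/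
theorem degree_variance (N : ℕ) (hN : 1 ≤ N) :
    (Even N →
      var (demMu N) (fun p => (p.1 : ℚ)) =
        (N : ℚ) * ((N : ℚ) - 1) * (2 * (N : ℚ) + 5) / 96) ∧
    (Odd N →
      var (demMu N) (fun p => (p.2 : ℚ)) =
        (N : ℚ) * ((N : ℚ) - 1) * (2 * (N : ℚ) + 5) / 96) := by
  refine ⟨fun h => var_fixedCoord N (N / 4) fun p => ?_,
    fun h => var_fixedCoord N ((N - 1) / 4) fun p => ?_⟩
  · simp [fixedCoord, h]
  · simp [fixedCoord, Nat.not_even_iff_odd.mpr h]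
end

section
/- (Covariance of the weight distribution, matching parity case.) For every even N ≥ 1, the covariance matrix of the degree a and the finite weight 2(a−b) with respect to μ_N is diagonal: Var_{μ_N}(a) = N(N−1)(2N+5)/96, Cov_{μ_N}(a, 2(a−b)) = 0, and Var_{μ_N}(2(a−b)) = N. -/
/-- The functional `f ↦ ∑ μ(p) f(p)` attached to a finitely supported signed measure `μ`. -/
noncomputable def weightSum (mu : (ℤ × ℤ) →₀ ℤ) : (ℤ × ℤ → ℚ) →ₗ[ℚ] ℚ where
  toFun f := mu.sum fun p c => (c : ℚ) * f p
  map_add' f g := by simp [Finsupp.sum, mul_add, Finset.sum_add_distrib]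
  map_smul' r f := by simp [Finsupp.sum, Finset.mul_sum, mul_left_comm]

theorem weightSum_single (p : ℤ × ℤ) (c : ℤ) (f : ℤ × ℤ → ℚ) :
    weightSum (Finsupp.single p c) f = c * f p := by
  simp [weightSum]

theorem weightSum_zero (f : ℤ × ℤ → ℚ) : weightSum 0 f = 0 := by
  simp [weightSum]

theorem weightSum_add (mu nu : (ℤ × ℤ) →₀ ℤ) (f : ℤ × ℤ → ℚ) :
    weightSum (mu + nu) f = weightSum mu f + weightSum nu f :=
  Finsupp.sum_add_index' (h := fun p (c : ℤ) => (c : ℚ) * f p) (by simp)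
    (by intros; push_cast; ring)

/-- `weightSum` as an additive map in the measure. -/
noncomputable def weightSumHom (f : ℤ × ℤ → ℚ) : ((ℤ × ℤ) →₀ ℤ) →+ ℚ where
  toFun mu := weightSum mu f
  map_zero' := weightSum_zero f
  map_add' mu nu := weightSum_add mu nu f

theorem weightSum_sum_smul (mu : (ℤ × ℤ) →₀ ℤ) (T : ℤ × ℤ → (ℤ × ℤ) →₀ ℤ) (f : ℤ × ℤ → ℚ) :
    weightSum (mu.sum fun p c => c • T p) f = weightSum mu fun p => weightSum (T p) f := by
  change weightSumHom f _ = mu.sum fun p c => (c : ℚ) * weightSumHom f (T p)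
  simp [Finsupp.sum, map_sum, map_zsmul]

/-- Telescoping of a signed sum `∑_{i=0}^{m}`. -/
theorem signed_sum_telescope (g G : ℤ → ℚ) (h : ∀ i, G (i + 1) - G i = g i) (m : ℤ) :
    ∑ i ∈ Finset.Icc (0 : ℤ) m, g i - ∑ i ∈ Finset.Icc (m + 1) (-1 : ℤ), g i
      = G (m + 1) - G 0 := by
  have key : ∀ (a : ℤ) (n : ℕ), ∑ i ∈ Finset.Icc a (a + n - 1), g i = G (a + n) - G a := by
    intro a n
    induction n with
    | zero => simp
    | succ n ih =>
      have hs : Finset.Icc a (a + (n + 1 : ℕ) - 1)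
          = insert (a + n : ℤ) (Finset.Icc a (a + n - 1)) := by
        ext x
        simp only [Finset.mem_Icc, Finset.mem_insert]
        push_cast
        omega
      rw [hs, Finset.sum_insert (by simp), ih, ← h]
      push_cast
      rw [← add_assoc]
      ring
  rcases le_total 0 (m + 1) with hm | hm
  · obtain ⟨n, hn⟩ := Int.eq_ofNat_of_zero_le hm
    have h1 := key 0 n
    rw [← hn] at h1
    rw [Finset.Icc_eq_empty (a := m + 1) (by omega)]
    simpa using h1
  · obtain ⟨n, hn⟩ := Int.eq_ofNat_of_zero_le (neg_nonneg.mpr hm)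
    have h1 := key (m + 1) n
    rw [← hn, show m + 1 + -(m + 1) = 0 by ring] at h1
    rw [Finset.Icc_eq_empty (b := m) (by omega), ← zero_sub (1 : ℤ), h1]
    simp

theorem weightSum_elemD0 (p : ℤ × ℤ) (f : ℤ × ℤ → ℚ) (G : ℤ → ℚ)
    (h : ∀ i, G (i + 1) - G i = f (p.1 + i, p.2)) :
    weightSum (elemD0 p) f = G (1 - 2 * p.1 + 2 * p.2 + 1) - G 0 := by
  rw [← signed_sum_telescope _ G h]
  change weightSumHom f (elemD0 p) = _
  simp only [elemD0, map_sub, map_sum]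
  simp [weightSumHom, weightSum_single]

theorem weightSum_elemD1 (p : ℤ × ℤ) (f : ℤ × ℤ → ℚ) (G : ℤ → ℚ)
    (h : ∀ i, G (i + 1) - G i = f (p.1, p.2 + i)) :
    weightSum (elemD1 p) f = G (2 * p.1 - 2 * p.2 + 1) - G 0 := by
  rw [← signed_sum_telescope _ G h]
  change weightSumHom f (elemD1 p) = _
  simp only [elemD1, map_sub, map_sum]
  simp [weightSumHom, weightSum_single]

/-- The moments of the pair `(A, Y)` under `L` which determine the covariance matrix at stage
`n`; here `A` is a shifted degree and `Y` half the finite weight for the last reflection. -/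
structure HasDemazureMoments (L : (ℤ × ℤ → ℚ) →ₗ[ℚ] ℚ) (A Y : ℤ × ℤ → ℚ) (n : ℕ) : Prop where
  one : L (fun _ => 1) = 2 ^ n
  y1 : L (fun p => Y p) = 0
  y2 : L (fun p => Y p ^ 2) = 2 ^ n * (n / 4)
  y3 : L (fun p => Y p ^ 3) = 0
  y4 : L (fun p => Y p ^ 4) = 2 ^ n * (n * (3 * n - 2) / 16)
  y5 : L (fun p => Y p ^ 5) = 0
  a : L (fun p => A p) = 2 ^ n * (n * (n + 1) / 8)
  ay1 : L (fun p => A p * Y p) = 0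
  ay2 : L (fun p => A p * Y p ^ 2)
    = 2 ^ n * ((n + 3 * n * (n - 1) + n * (n - 1) * (n - 2) / 2) / 16)
  ay3 : L (fun p => A p * Y p ^ 3) = 0
  a2 : L (fun p => A p ^ 2)
    = 2 ^ n * (n * (n - 1) * (2 * n + 5) / 96 + (n * (n + 1) / 8) ^ 2)
  a2y1 : L (fun p => A p ^ 2 * Y p) = 0

theorem HasDemazureMoments.apply_polynomial {L : (ℤ × ℤ → ℚ) →ₗ[ℚ] ℚ} {A Y : ℤ × ℤ → ℚ} {n : ℕ}
    (h : HasDemazureMoments L A Y n) (c0 c1 c2 c3 c4 c5 d0 d1 d2 d3 e0 e1 : ℚ) :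
    L (fun p => c0 + c1 * Y p + c2 * Y p ^ 2 + c3 * Y p ^ 3 + c4 * Y p ^ 4 + c5 * Y p ^ 5
        + d0 * A p + d1 * (A p * Y p) + d2 * (A p * Y p ^ 2) + d3 * (A p * Y p ^ 3)
        + e0 * A p ^ 2 + e1 * (A p ^ 2 * Y p))
      = 2 ^ n * (c0 + c2 * (n / 4) + c4 * (n * (3 * n - 2) / 16) + d0 * (n * (n + 1) / 8)
        + d2 * ((n + 3 * n * (n - 1) + n * (n - 1) * (n - 2) / 2) / 16)
        + e0 * (n * (n - 1) * (2 * n + 5) / 96 + (n * (n + 1) / 8) ^ 2)) := by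
  have hfun : (fun p => c0 + c1 * Y p + c2 * Y p ^ 2 + c3 * Y p ^ 3 + c4 * Y p ^ 4 + c5 * Y p ^ 5
        + d0 * A p + d1 * (A p * Y p) + d2 * (A p * Y p ^ 2) + d3 * (A p * Y p ^ 3)
        + e0 * A p ^ 2 + e1 * (A p ^ 2 * Y p))
      = c0 • (fun _ => 1) + c1 • (fun p => Y p) + c2 • (fun p => Y p ^ 2) + c3 • (fun p => Y p ^ 3)
        + c4 • (fun p => Y p ^ 4) + c5 • (fun p => Y p ^ 5) + d0 • (fun p => A p)
        + d1 • (fun p => A p * Y p) + d2 • (fun p => A p * Y p ^ 2) + d3 • (fun p => A p * Y p ^ 3)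
        + e0 • (fun p => A p ^ 2) + e1 • (fun p => A p ^ 2 * Y p) := by
    ext p
    simp
  rw [hfun]
  simp only [map_add, map_smul, smul_eq_mul, h.one, h.y1, h.y2, h.y3, h.y4, h.y5, h.a, h.ay1,
    h.ay2, h.ay3, h.a2, h.a2y1]
  ring

/-- `L'` arises from `L` by a Demazure operator: in the coordinates `A' = A + 1/4 - Y` and
`Y' = 1/2 - Y`, the operator fixes `A'` and spreads `Y'` over the string `-Y', …, Y'`. The sum
over the string is expressed through an antidifference `F`. -/
def IsDemazureStep (L L' : (ℤ × ℤ → ℚ) →ₗ[ℚ] ℚ) (A Y A' Y' : ℤ × ℤ → ℚ) : Prop :=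
  ∀ f F : ℚ → ℚ → ℚ, (∀ x y, F x (y + 1) - F x y = f x y) →
    L' (fun p => f (A' p) (Y' p))
      = L (fun p => F (A p + 1 / 4 - Y p) (3 / 2 - Y p) - F (A p + 1 / 4 - Y p) (Y p - 1 / 2))

theorem isDemazureStep_demD0 (mu : (ℤ × ℤ) →₀ ℤ) :
    IsDemazureStep (weightSum mu) (weightSum (demD0 mu))
      (fun p => p.1) (fun p => p.1 - p.2) (fun p => p.2 + 1 / 4) (fun p => 1 / 2 - p.1 + p.2) := by
  intro f F hF
  rw [demD0, weightSum_sum_smul]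
  congr 1
  funext p
  rw [weightSum_elemD0 p _ fun i => -F (p.2 + 1 / 4) (1 / 2 - p.1 - i + p.2 + 1)]
  · push_cast
    ring_nf
  · intro i
    push_cast
    rw [← hF]
    ring_nf

theorem isDemazureStep_demD1 (mu : (ℤ × ℤ) →₀ ℤ) :
    IsDemazureStep (weightSum mu) (weightSum (demD1 mu))
      (fun p => p.2 + 1 / 4) (fun p => 1 / 2 - p.1 + p.2) (fun p => p.1) (fun p => p.1 - p.2) := by
  intro f F hF
  rw [demD1, weightSum_sum_smul]
  congr 1
  funext p
  rw [weightSum_elemD1 p _ fun i => -F p.1 (p.1 - p.2 - i + 1)]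
  · push_cast
    ring_nf
  · intro i
    push_cast
    rw [← hF]
    ring_nf

theorem HasDemazureMoments.step {L L' : (ℤ × ℤ → ℚ) →ₗ[ℚ] ℚ} {A Y A' Y' : ℤ × ℤ → ℚ} {n : ℕ}
    (h : HasDemazureMoments L A Y n) (hs : IsDemazureStep L L' A Y A' Y') :
    HasDemazureMoments L' A' Y' (n + 1) := by
  have even_moment (f F : ℚ → ℚ → ℚ) (hF : ∀ x y, F x (y + 1) - F x y = f x y)
      (c0 c1 c2 c3 c4 c5 d0 d1 d2 d3 e0 e1 : ℚ)
      (hc : ∀ x y, F (x + 1 / 4 - y) (3 / 2 - y) - F (x + 1 / 4 - y) (y - 1 / 2)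
        = c0 + c1 * y + c2 * y ^ 2 + c3 * y ^ 3 + c4 * y ^ 4 + c5 * y ^ 5
          + d0 * x + d1 * (x * y) + d2 * (x * y ^ 2) + d3 * (x * y ^ 3)
          + e0 * x ^ 2 + e1 * (x ^ 2 * y)) :
      L' (fun p => f (A' p) (Y' p)) = 2 ^ n * (c0 + c2 * (n / 4) + c4 * (n * (3 * n - 2) / 16)
        + d0 * (n * (n + 1) / 8)
        + d2 * ((n + 3 * n * (n - 1) + n * (n - 1) * (n - 2) / 2) / 16)
        + e0 * (n * (n - 1) * (2 * n + 5) / 96 + (n * (n + 1) / 8) ^ 2)) := by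
    rw [hs f F hF, ← h.apply_polynomial c0 c1 c2 c3 c4 c5 d0 d1 d2 d3 e0 e1]
    simp only [hc]
  have odd_moment (f F : ℚ → ℚ → ℚ) (hF : ∀ x y, F x (y + 1) - F x y = f x y)
      (hc : ∀ x y, F x (1 - y) = F x y) : L' (fun p => f (A' p) (Y' p)) = 0 := by
    rw [hs f F hF, ← map_zero L]
    congr 1
    funext p
    rw [← hc, show 1 - (3 / 2 - Y p) = Y p - 1 / 2 by ring, sub_self, Pi.zero_apply]
  constructor
  · rw [even_moment (fun _ _ => 1) (fun _ y => y) (by intros; ring)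
      2 (-2) 0 0 0 0 0 0 0 0 0 0 (by intros; ring)]
    ring
  · exact odd_moment (fun _ y => y) (fun _ y => (y ^ 2 - y) / 2) (by intros; ring)
      (by intros; ring)
  · rw [even_moment (fun _ y => y ^ 2) (fun _ y => y ^ 3 / 3 - y ^ 2 / 2 + y / 6)
      (by intros; ring)
      (1 / 2) (-11 / 6) 2 (-2 / 3) 0 0 0 0 0 0 0 0 (by intros; ring)]
    push_cast
    ring
  · exact odd_moment (fun _ y => y ^ 3) (fun _ y => ((y ^ 2 - y) / 2) ^ 2) (by intros; ring)
      (by intros; ring)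
  · rw [even_moment (fun _ y => y ^ 4) (fun _ y => y ^ 5 / 5 - y ^ 4 / 2 + y ^ 3 / 3 - y / 30)
      (by intros; ring)
      (1 / 8) (-127 / 120) 3 (-11 / 3) 2 (-2 / 5) 0 0 0 0 0 0 (by intros; ring)]
    push_cast
    ring
  · exact odd_moment (fun _ y => y ^ 5)
      (fun _ y => y ^ 6 / 6 - y ^ 5 / 2 + 5 * y ^ 4 / 12 - y ^ 2 / 12) (by intros; ring)
      (by intros; ring)
  · rw [even_moment (fun x _ => x) (fun x y => x * y) (by intros; ring)
      (1 / 2) (-5 / 2) 2 0 0 0 2 (-2) 0 0 0 0 (by intros; ring)]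
    push_cast
    ring
  · exact odd_moment (fun x y => x * y) (fun x y => x * ((y ^ 2 - y) / 2)) (by intros; ring)
      (by intros; ring)
  · rw [even_moment (fun x y => x * y ^ 2) (fun x y => x * (y ^ 3 / 3 - y ^ 2 / 2 + y / 6))
      (by intros; ring)
      (1 / 8) (-23 / 24) (7 / 3) (-13 / 6) (2 / 3) 0 (1 / 2) (-11 / 6) 2 (-2 / 3) 0 0
      (by intros; ring)]
    push_cast
    ring
  · exact odd_moment (fun x y => x * y ^ 3) (fun x y => x * ((y ^ 2 - y) / 2) ^ 2)
      (by intros; ring) (by intros; ring)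
  · rw [even_moment (fun x _ => x ^ 2) (fun x y => x ^ 2 * y) (by intros; ring)
      (1 / 8) (-9 / 8) 3 (-2) 0 0 1 (-5) 4 0 2 (-2) (by intros; ring)]
    push_cast
    ring
  · exact odd_moment (fun x y => x ^ 2 * y) (fun x y => x ^ 2 * ((y ^ 2 - y) / 2))
      (by intros; ring) (by intros; ring)

theorem hasDemazureMoments_demMu (n : ℕ) :
    (Even n → HasDemazureMoments (weightSum (demMu n)) (fun p => p.1) (fun p => p.1 - p.2) n) ∧
    (¬Even n → HasDemazureMoments (weightSum (demMu n)) (fun p => p.2 + 1 / 4)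
      (fun p => 1 / 2 - p.1 + p.2) n) := by
  induction n with
  | zero =>
    refine ⟨fun _ => ?_, fun h => absurd Even.zero h⟩
    constructor <;> simp [demMu, weightSum_single]
  | succ n ih =>
    rw [Nat.even_add_one, not_not, demMu]
    refine ⟨fun h => ?_, fun h => ?_⟩
    · rw [if_neg h]
      exact (ih.2 h).step (isDemazureStep_demD1 _)
    · rw [if_pos h]
      exact (ih.1 h).step (isDemazureStep_demD0 _)

theorem expVal_eq_weightSum (mu : (ℤ × ℤ) →₀ ℤ) (f : ℤ × ℤ → ℚ) :
    expVal mu f = weightSum mu f / weightSum mu (fun _ => 1) := by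
  simp [expVal, totalMass, weightSum]

/-- Covariance matrix of the weight distribution, matching parity case: for even `N ≥ 1`,
the covariance matrix of the degree `a` and the finite weight `2(a-b)` with respect to `μ_N`
is diagonal with entries `N(N-1)(2N+5)/96` and `N`. -/
theorem covariance_matrix_matching_parity (N : ℕ) (hN : 1 ≤ N) (hEven : Even N) :
    var (demMu N) (fun p => (p.1 : ℚ)) =
      (N : ℚ) * ((N : ℚ) - 1) * (2 * (N : ℚ) + 5) / 96 ∧
    covar (demMu N) (fun p => (p.1 : ℚ)) (fun p => 2 * ((p.1 : ℚ) - (p.2 : ℚ))) = 0 ∧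
    var (demMu N) (fun p => 2 * ((p.1 : ℚ) - (p.2 : ℚ))) = (N : ℚ) := by
  have h := (hasDemazureMoments_demMu N).1 hEven
  have hexp (c0 c2 d0 d1 e0 : ℚ) (f : ℤ × ℤ → ℚ)
      (hf : ∀ p, f p = c0 * (p.1 - p.2) + c2 * (p.1 - p.2 : ℚ) ^ 2 + d0 * p.1
        + d1 * (p.1 * (p.1 - p.2)) + e0 * (p.1 : ℚ) ^ 2) :
      expVal (demMu N) f = c2 * (N / 4) + d0 * (N * (N + 1) / 8)
        + e0 * (N * (N - 1) * (2 * N + 5) / 96 + (N * (N + 1) / 8) ^ 2) := by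
    have hpoly := h.apply_polynomial 0 c0 c2 0 0 0 d0 d1 0 0 e0 0
    have hfun : f = fun p => 0 + c0 * ((p.1 : ℚ) - p.2) + c2 * ((p.1 : ℚ) - p.2) ^ 2
        + 0 * ((p.1 : ℚ) - p.2) ^ 3 + 0 * ((p.1 : ℚ) - p.2) ^ 4 + 0 * ((p.1 : ℚ) - p.2) ^ 5
        + d0 * (p.1 : ℚ) + d1 * ((p.1 : ℚ) * ((p.1 : ℚ) - p.2))
        + 0 * ((p.1 : ℚ) * ((p.1 : ℚ) - p.2) ^ 2) + 0 * ((p.1 : ℚ) * ((p.1 : ℚ) - p.2) ^ 3)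
        + e0 * (p.1 : ℚ) ^ 2 + 0 * ((p.1 : ℚ) ^ 2 * ((p.1 : ℚ) - p.2)) := by
      funext p
      rw [hf]
      ring
    rw [expVal_eq_weightSum, h.one, hfun, hpoly, mul_div_cancel_left₀ _ (by positivity)]
    ring
  have ha := hexp 0 0 1 0 0 (fun p => (p.1 : ℚ)) (by intros; ring)
  have hy := hexp 2 0 0 0 0 (fun p => 2 * ((p.1 : ℚ) - p.2)) (by intros; ring)
  simp only [var, covar, ha, hy]
  refine ⟨?_, ?_, ?_⟩
  · rw [hexp 0 0 0 0 1 _ (by intros; ring)]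
    ring
  · rw [hexp 0 0 0 2 0 _ (by intros; ring)]
    ring
  · rw [hexp 0 4 0 0 0 _ (by intros; ring)]
    ring
end

section
/- (Covariance of the weight distribution, mismatched parity case.) For every odd N ≥ 1, the covariance matrix of the degree a and the finite weight 2(a−b) with respect to μ_N is given by: Var_{μ_N}(a) = N(N−1)(2N+5)/96 + N/4, Cov_{μ_N}(a, 2(a−b)) = N/2, and Var_{μ_N}(2(a−b)) = N. -/
/-- The integral `∑_p μ(p) f(p)` of `f` against a finitely supported signed measure `μ`. -/
noncomputable def integ (mu : (ℤ × ℤ) →₀ ℤ) (f : ℤ × ℤ → ℚ) : ℚ :=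
  mu.sum fun p c => (c : ℚ) * f p

lemma integ_single (p : ℤ × ℤ) (c : ℤ) (f : ℤ × ℤ → ℚ) :
    integ (Finsupp.single p c) f = c * f p := by
  simp [integ]

lemma integ_zero (f : ℤ × ℤ → ℚ) : integ 0 f = 0 := by
  simp [integ]

lemma integ_add (mu nu : (ℤ × ℤ) →₀ ℤ) (f : ℤ × ℤ → ℚ) :
    integ (mu + nu) f = integ mu f + integ nu f :=
  Finsupp.sum_add_index' (by simp) (by intros; push_cast; ring)

/-- `integ` as an additive map in the measure. -/
noncomputable def integHom (f : ℤ × ℤ → ℚ) : ((ℤ × ℤ) →₀ ℤ) →+ ℚ where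
  toFun mu := integ mu f
  map_zero' := integ_zero f
  map_add' mu nu := integ_add mu nu f

lemma integHom_apply (f : ℤ × ℤ → ℚ) (mu : (ℤ × ℤ) →₀ ℤ) : integHom f mu = integ mu f := rfl

lemma integ_sum_smul (mu : (ℤ × ℤ) →₀ ℤ) (T : ℤ × ℤ → ((ℤ × ℤ) →₀ ℤ)) (f : ℤ × ℤ → ℚ) :
    integ (mu.sum fun p c => c • T p) f = integ mu fun p => integ (T p) f := by
  rw [← integHom_apply, Finsupp.sum, map_sum]
  simp [integHom_apply, integ, Finsupp.sum, map_zsmul, zsmul_eq_mul]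

/-- Every function on `ℤ` has a discrete antiderivative. -/
lemma exists_antidifference (f : ℤ → ℚ) : ∃ F : ℤ → ℚ, ∀ n, F (n + 1) - F n = f n := by
  refine ⟨fun n => ∑ i ∈ Finset.Ico 0 n, f i - ∑ i ∈ Finset.Ico n 0, f i, fun n => ?_⟩
  dsimp only
  rcases le_or_gt 0 n with h | h
  · have hs : Finset.Ico 0 (n + 1) = insert n (Finset.Ico 0 n) := by
      ext; simp; omega
    rw [hs, Finset.sum_insert (by simp), Finset.Ico_eq_empty (a := n + 1) (by omega),
      Finset.Ico_eq_empty (a := n) (by omega)]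
    simp
  · have hs : Finset.Ico n 0 = insert n (Finset.Ico (n + 1) 0) := by
      ext; simp; omega
    rw [hs, Finset.sum_insert (by simp), Finset.Ico_eq_empty (b := n + 1) (by omega),
      Finset.Ico_eq_empty (b := n) (by omega)]
    simp

lemma sum_Icc_antidifference (F : ℤ → ℚ) (u : ℤ) (m : ℕ) :
    ∑ i ∈ Finset.Icc u (u + m - 1), (F (i + 1) - F i) = F (u + m) - F u := by
  induction m with
  | zero => simp
  | succ m ih =>
    have hs : Finset.Icc u (u + (m + 1 : ℕ) - 1) = insert (u + m) (Finset.Icc u (u + m - 1)) := by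
      ext; simp; omega
    rw [hs, Finset.sum_insert (by simp), ih]
    push_cast
    rw [← add_assoc]
    ring

/-- Telescoping for the signed sum `∑_{i=0}^{n}`, `n` any integer. -/
lemma signed_sum_antidifference (F : ℤ → ℚ) (n : ℤ) :
    ∑ i ∈ Finset.Icc 0 n, (F (i + 1) - F i) - ∑ i ∈ Finset.Icc (n + 1) (-1), (F (i + 1) - F i)
      = F (n + 1) - F 0 := by
  rcases le_or_gt (-1) n with h | h
  · obtain ⟨m, hm⟩ := Int.eq_ofNat_of_zero_le (show 0 ≤ n + 1 by omega)
    have h₁ := sum_Icc_antidifference F 0 m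
    rw [← hm, show 0 + (n + 1) - 1 = n by ring, zero_add] at h₁
    rw [h₁, Finset.Icc_eq_empty (a := n + 1) (by omega)]
    simp
  · obtain ⟨m, hm⟩ := Int.eq_ofNat_of_zero_le (show 0 ≤ -(n + 1) by omega)
    have h₁ := sum_Icc_antidifference F (n + 1) m
    rw [← hm, show n + 1 + -(n + 1) - 1 = -1 by ring, show n + 1 + -(n + 1) = 0 by ring] at h₁
    rw [h₁, Finset.Icc_eq_empty (a := 0) (by omega)]
    simp

lemma integ_elemD0 {f : ℤ × ℤ → ℚ} {F : ℤ → ℤ → ℚ}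
    (hF : ∀ b a, F b (a + 1) - F b a = f (a, b)) (p : ℤ × ℤ) :
    integ (elemD0 p) f = F p.2 (2 - p.1 + 2 * p.2) - F p.2 p.1 := by
  have h := signed_sum_antidifference (fun i => F p.2 (p.1 + i)) (1 - 2 * p.1 + 2 * p.2)
  simp only [← add_assoc, hF] at h
  rw [← integHom_apply, elemD0, map_sub, map_sum, map_sum]
  simp only [integHom_apply, integ_single, Int.cast_one, one_mul]
  rw [h]
  congr 2 <;> ring

lemma integ_elemD1 {f : ℤ × ℤ → ℚ} {F : ℤ → ℤ → ℚ}
    (hF : ∀ a b, F a (b + 1) - F a b = f (a, b)) (p : ℤ × ℤ) :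
    integ (elemD1 p) f = F p.1 (2 * p.1 - p.2 + 1) - F p.1 p.2 := by
  have h := signed_sum_antidifference (fun i => F p.1 (p.2 + i)) (2 * p.1 - 2 * p.2)
  simp only [← add_assoc, hF] at h
  rw [← integHom_apply, elemD1, map_sub, map_sum, map_sum]
  simp only [integHom_apply, integ_single, Int.cast_one, one_mul]
  rw [h]
  congr 2 <;> ring

/-- The functional `f ↦ ∑_{k,e} c_{k,e} f(k,e)`, where `∑_e c_{k,e} q^e` is the Gaussian binomial
coefficient `[N choose k]_q`, defined through the `q`-Pascal rule. -/
def qBinomSum : ℕ → (ℤ → ℤ → ℚ) → ℚ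
  | 0, f => f 0 0
  | N + 1, f => qBinomSum N f + qBinomSum N fun k e => f (k + 1) (e + N - k)

lemma qBinomSum_succ (N : ℕ) (f : ℤ → ℤ → ℚ) :
    qBinomSum (N + 1) f = qBinomSum N f + qBinomSum N fun k e => f (k + 1) (e + N - k) := rfl

lemma qBinomSum_sub (N : ℕ) (f g : ℤ → ℤ → ℚ) :
    qBinomSum N (fun k e => f k e - g k e) = qBinomSum N f - qBinomSum N g := by
  induction N generalizing f g with
  | zero => rfl
  | succ N ih => simp only [qBinomSum, ih]; ring

/-- The second `q`-Pascal rule. -/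
lemma qBinomSum_succ' (N : ℕ) (f : ℤ → ℤ → ℚ) :
    qBinomSum (N + 1) f
      = qBinomSum N (fun k e => f k (e + k)) + qBinomSum N fun k e => f (k + 1) e := by
  induction N generalizing f with
  | zero => simp [qBinomSum]
  | succ N ih =>
    rw [qBinomSum, ih, ih, qBinomSum, qBinomSum]
    have h₁ : (fun k e : ℤ => f (k + 1) (e + k + ((N + 1 : ℕ) : ℤ) - k))
        = fun k e => f (k + 1) (e + N - k + (k + 1)) := by
      funext k e; congr 1; push_cast; ring
    have h₂ : (fun k e : ℤ => f (k + 1 + 1) (e + ((N + 1 : ℕ) : ℤ) - (k + 1)))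
        = fun k e => f (k + 1 + 1) (e + N - k) := by
      funext k e; congr 1; push_cast; ring
    rw [h₁, h₂]
    ring

/-- The symmetry `[N choose k]_q = [N choose N - k]_q`. -/
lemma qBinomSum_reflect (N : ℕ) (f : ℤ → ℤ → ℚ) :
    qBinomSum N f = qBinomSum N fun k e => f (N - k) e := by
  induction N generalizing f with
  | zero => simp [qBinomSum]
  | succ N ih =>
    rw [qBinomSum_succ' N fun k e => f ((N + 1 : ℕ) - k) e, qBinomSum, ih f,
      ih fun k e => f (k + 1) (e + N - k), add_comm]
    congr 2 <;> funext k e <;> congr 1 <;> push_cast <;> ring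

lemma integ_demMu_odd_of_even (n : ℕ)
    (h : ∀ f, integ (demMu (2 * n)) f
      = qBinomSum (2 * n) fun k e => f (n ^ 2 - e, n ^ 2 - e - k + n)) (f : ℤ × ℤ → ℚ) :
    integ (demMu (2 * n + 1)) f
      = qBinomSum (2 * n + 1) fun k e => f (n ^ 2 + k - e, n ^ 2 + n - e) := by
  choose G hG using fun b : ℤ => exists_antidifference fun a => f (a, b)
  rw [demMu, if_pos (even_two_mul n), demD0, integ_sum_smul, h]
  simp only [integ_elemD0 hG, ← hG]
  rw [qBinomSum_sub, qBinomSum_sub, qBinomSum_succ (2 * n), qBinomSum_succ' (2 * n),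
    qBinomSum_reflect (2 * n)]
  have cancel {x y u v w z : ℚ} (hx : x = v) (hy : y = w) (hu : u = z) :
      x - y = u + v - (w + z) := by
    rw [hx, hy, hu]; ring
  apply cancel <;> congr 1 <;> funext k e <;> congr 1 <;> push_cast <;> ring

lemma integ_demMu_even_of_odd (n : ℕ)
    (h : ∀ f, integ (demMu (2 * n + 1)) f
      = qBinomSum (2 * n + 1) fun k e => f (n ^ 2 + k - e, n ^ 2 + n - e)) (f : ℤ × ℤ → ℚ) :
    integ (demMu (2 * n + 1 + 1)) f
      = qBinomSum (2 * n + 1 + 1) fun k e =>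
        f ((n + 1) ^ 2 - e, (n + 1) ^ 2 - e - k + (n + 1)) := by
  choose G hG using fun a : ℤ => exists_antidifference fun b => f (a, b)
  rw [demMu, if_neg (by simp), demD1, integ_sum_smul, h]
  simp only [integ_elemD1 hG, ← hG]
  rw [qBinomSum_sub, qBinomSum_sub, qBinomSum_succ' (2 * n + 1), qBinomSum_succ (2 * n + 1),
    qBinomSum_reflect (2 * n + 1)]
  have cancel {x y u v w z : ℚ} (hx : x = u) (hy : y = z) (hv : v = w) :
      x - y = u + v - (w + z) := by
    rw [hx, hy, hv]; ring
  apply cancel <;> congr 1 <;> funext k e <;> congr 1 <;> push_cast <;> ring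

/-- The weight distribution of the Demazure module in terms of Gaussian binomials. -/
lemma integ_demMu_even (n : ℕ) (f : ℤ × ℤ → ℚ) :
    integ (demMu (2 * n)) f
      = qBinomSum (2 * n) fun k e => f (n ^ 2 - e, n ^ 2 - e - k + n) := by
  induction n generalizing f with
  | zero => simp [demMu, integ_single, qBinomSum]
  | succ n ih =>
    rw [show 2 * (n + 1) = 2 * n + 1 + 1 by ring,
      integ_demMu_even_of_odd n (integ_demMu_odd_of_even n ih)]
    push_cast
    rfl

lemma integ_demMu_odd (n : ℕ) (f : ℤ × ℤ → ℚ) :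
    integ (demMu (2 * n + 1)) f
      = qBinomSum (2 * n + 1) fun k e => f (n ^ 2 + k - e, n ^ 2 + n - e) :=
  integ_demMu_odd_of_even n (integ_demMu_even n) f

/-- Moments of order at most two of the Gaussian binomial distribution. -/
lemma qBinomSum_quadratic (N : ℕ) (c₀ c₁ c₂ c₃ c₄ c₅ : ℚ) :
    qBinomSum N (fun k e => c₀ + c₁ * k + c₂ * e + c₃ * k ^ 2 + c₄ * (k * e) + c₅ * e ^ 2)
      = 2 ^ N * (c₀ + c₁ * (N / 2) + c₂ * (N * (N - 1) / 8) + c₃ * (N / 4 + N ^ 2 / 4)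
        + c₄ * (N / 2 * (N * (N - 1) / 8))
        + c₅ * (N * (N - 1) * (2 * N + 5) / 96 + (N * (N - 1) / 8) ^ 2)) := by
  induction N generalizing c₀ c₁ c₂ c₃ c₄ c₅ with
  | zero => simp [qBinomSum]
  | succ N ih =>
    have h : (fun k e : ℤ => c₀ + c₁ * ((k + 1 : ℤ) : ℚ) + c₂ * ((e + N - k : ℤ) : ℚ)
          + c₃ * ((k + 1 : ℤ) : ℚ) ^ 2 + c₄ * (((k + 1 : ℤ) : ℚ) * ((e + N - k : ℤ) : ℚ))
          + c₅ * ((e + N - k : ℤ) : ℚ) ^ 2)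
        = fun k e : ℤ => (c₀ + c₁ + c₂ * N + c₃ + c₄ * N + c₅ * N ^ 2)
          + (c₁ - c₂ + 2 * c₃ + c₄ * (N - 1) - 2 * c₅ * N) * (k : ℚ)
          + (c₂ + c₄ + 2 * c₅ * N) * (e : ℚ)
          + (c₃ - c₄ + c₅) * (k : ℚ) ^ 2 + (c₄ - 2 * c₅) * ((k : ℚ) * e)
          + c₅ * (e : ℚ) ^ 2 := by
      funext k e; push_cast; ring
    rw [qBinomSum, h, ih, ih]
    push_cast
    ring

lemma expVal_demMu_odd (n : ℕ) (c₀ c₁ c₂ c₃ c₄ c₅ : ℚ) (f : ℤ × ℤ → ℚ)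
    (hf : ∀ k e : ℤ, f (n ^ 2 + k - e, n ^ 2 + n - e)
      = c₀ + c₁ * k + c₂ * e + c₃ * k ^ 2 + c₄ * (k * e) + c₅ * e ^ 2) (N : ℚ)
    (hN : N = 2 * n + 1) :
    expVal (demMu (2 * n + 1)) f
      = c₀ + c₁ * (N / 2) + c₂ * (N * (N - 1) / 8) + c₃ * (N / 4 + N ^ 2 / 4)
        + c₄ * (N / 2 * (N * (N - 1) / 8))
        + c₅ * (N * (N - 1) * (2 * N + 5) / 96 + (N * (N - 1) / 8) ^ 2) := by
  have hmass : totalMass (demMu (2 * n + 1)) = 2 ^ (2 * n + 1) := by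
    have h := qBinomSum_quadratic (2 * n + 1) 1 0 0 0 0 0
    simp only [zero_mul, add_zero, mul_one] at h
    rw [← h, ← integ_demMu_odd n fun _ => 1]
    simp [totalMass, integ]
  have hint : integ (demMu (2 * n + 1)) f = _ := integ_demMu_odd n f
  simp only [hf, qBinomSum_quadratic] at hint
  rw [expVal, hmass, div_eq_iff (by positivity)]
  rw [integ] at hint
  rw [hint, hN]
  push_cast
  ring

/-- Covariance matrix of the weight distribution, mismatched parity case: for odd `N ≥ 1`,
`Var_{μ_N}(a) = N(N-1)(2N+5)/96 + N/4`, `Cov_{μ_N}(a, 2(a-b)) = N/2`, and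
`Var_{μ_N}(2(a-b)) = N`. -/
theorem covariance_matrix_mismatched_parity (N : ℕ) (hN : 1 ≤ N) (hOdd : Odd N) :
    var (demMu N) (fun p => (p.1 : ℚ)) =
      (N : ℚ) * ((N : ℚ) - 1) * (2 * (N : ℚ) + 5) / 96 + (N : ℚ) / 4 ∧
    covar (demMu N) (fun p => (p.1 : ℚ)) (fun p => 2 * ((p.1 : ℚ) - (p.2 : ℚ))) =
      (N : ℚ) / 2 ∧
    var (demMu N) (fun p => 2 * ((p.1 : ℚ) - (p.2 : ℚ))) = (N : ℚ) := by
  obtain ⟨n, rfl⟩ := hOdd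
  have hN' : ((2 * n + 1 : ℕ) : ℚ) = 2 * n + 1 := by push_cast; ring
  generalize ((2 * n + 1 : ℕ) : ℚ) = M at hN'
  have ha := expVal_demMu_odd n (n ^ 2) 1 (-1) 0 0 0 (fun p => (p.1 : ℚ))
    (by intros; push_cast; ring) M hN'
  have hx := expVal_demMu_odd n (-2 * n) 2 0 0 0 0 (fun p => 2 * ((p.1 : ℚ) - (p.2 : ℚ)))
    (by intros; push_cast; ring) M hN'
  have haa := expVal_demMu_odd n (n ^ 4) (2 * n ^ 2) (-2 * n ^ 2) 1 (-2) 1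
    (fun p => (p.1 : ℚ) * (p.1 : ℚ)) (by intros; push_cast; ring) M hN'
  have hax := expVal_demMu_odd n (-2 * n ^ 3) (2 * n ^ 2 - 2 * n) (2 * n) 2 (-2) 0
    (fun p => (p.1 : ℚ) * (2 * ((p.1 : ℚ) - (p.2 : ℚ)))) (by intros; push_cast; ring) M hN'
  have hxx := expVal_demMu_odd n (4 * n ^ 2) (-8 * n) 0 4 0 0
    (fun p => 2 * ((p.1 : ℚ) - (p.2 : ℚ)) * (2 * ((p.1 : ℚ) - (p.2 : ℚ))))
    (by intros; push_cast; ring) M hN'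
  simp only [var, covar, ha, hx, haa, hax, hxx]
  refine ⟨?_, ?_, ?_⟩ <;> ring
end

section
/- (Weak law of large numbers for level-1 Demazure modules.) For each k ≥ 1 let ν_k be the probability measure on ℝ² defined by ν_k = 4^{−k} · Σ_{(a,b)∈ℤ²} μ_{2k}(a,b) · δ_{(a/k², (a−b)/k)}, i.e. the normalized weight distribution of V_{(s₁s₀)^k}(Λ₀) with the degree rescaled by its maximum k² and the finite weight rescaled so that its support just fits into [−1,1]. Then ν_k converges weakly to the Dirac measure δ_{(1/2, 0)} as k → ∞. -/
open MeasureTheory in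
/-- The normalized weight distribution of `V_{(s₁s₀)^k}(Λ₀)`, as a measure on `ℝ²`: the
degree `a` is rescaled by its maximum `k²` and the finite weight (proportional to `a - b`,
whose maximum absolute value is `k`) is rescaled by `k`, so that the support just fits into
`[0,1] × [-1,1]`. -/
noncomputable def demNu (k : ℕ) : Measure (ℝ × ℝ) :=
  ((4 : ENNReal) ^ k)⁻¹ •
    ∑ p ∈ (demMu (2 * k)).support,
      (ENNReal.ofReal (((demMu (2 * k)) p : ℤ) : ℝ)) •
        Measure.dirac ((p.1 : ℝ) / (k : ℝ) ^ 2, ((p.1 : ℝ) - (p.2 : ℝ)) / (k : ℝ))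

lemma sum_Icc_single_snd_apply (x y l u a b : ℤ) :
    (∑ i ∈ Finset.Icc l u, Finsupp.single (x, y + i) (1 : ℤ)) (a, b) =
      if x = a ∧ l ≤ b - y ∧ b - y ≤ u then 1 else 0 := by
  have h : ∀ i : ℤ, (Finsupp.single (x, y + i) (1 : ℤ)) (a, b) =
      if i = b - y then (if x = a then 1 else 0) else 0 := by
    intro i
    simp only [Finsupp.single_apply, Prod.mk.injEq]
    split_ifs <;> first | rfl | omega
  simp only [Finsupp.finsetSum_apply, h, Finset.sum_ite_eq', Finset.mem_Icc]
  split_ifs <;> first | rfl | omega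

lemma sum_Icc_single_fst_apply (x y l u a b : ℤ) :
    (∑ i ∈ Finset.Icc l u, Finsupp.single (x + i, y) (1 : ℤ)) (a, b) =
      if y = b ∧ l ≤ a - x ∧ a - x ≤ u then 1 else 0 := by
  have h : ∀ i : ℤ, (Finsupp.single (x + i, y) (1 : ℤ)) (a, b) =
      if i = a - x then (if y = b then 1 else 0) else 0 := by
    intro i
    simp only [Finsupp.single_apply, Prod.mk.injEq]
    split_ifs <;> first | rfl | omega
  simp only [Finsupp.finsetSum_apply, h, Finset.sum_ite_eq', Finset.mem_Icc]
  split_ifs <;> first | rfl | omega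

lemma elemD0_apply_sub (p : ℤ × ℤ) (a b : ℤ) :
    elemD0 p (a, b) - elemD0 p (a - 1, b) =
      Finsupp.single p (1 : ℤ) (a, b) - Finsupp.single p (1 : ℤ) (2 * b + 2 - a, b) := by
  obtain ⟨x, y⟩ := p
  simp only [elemD0, Finsupp.sub_apply, sum_Icc_single_fst_apply, Finsupp.single_apply,
    Prod.mk.injEq]
  split_ifs <;> omega

lemma elemD1_apply_sub (p : ℤ × ℤ) (a b : ℤ) :
    elemD1 p (a, b) - elemD1 p (a, b - 1) =
      Finsupp.single p (1 : ℤ) (a, b) - Finsupp.single p (1 : ℤ) (a, 2 * a + 1 - b) := by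
  obtain ⟨x, y⟩ := p
  simp only [elemD1, Finsupp.sub_apply, sum_Icc_single_snd_apply, Finsupp.single_apply,
    Prod.mk.injEq]
  split_ifs <;> omega

/-- The difference equation in `a` satisfied by `D₀ μ`. -/
lemma demD0_apply_sub (mu : (ℤ × ℤ) →₀ ℤ) (a b : ℤ) :
    demD0 mu (a, b) - demD0 mu (a - 1, b) = mu (a, b) - mu (2 * b + 2 - a, b) := by
  induction mu using Finsupp.induction_linear with
  | zero => simp [demD0]
  | add f g hf hg =>
    have h : demD0 (f + g) = demD0 f + demD0 g :=
      Finsupp.sum_add_index' (by simp) (fun _ _ _ => add_smul _ _ _)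
    simp only [h, Finsupp.add_apply]
    linarith
  | single p c =>
    have h : demD0 (Finsupp.single p c) = c • elemD0 p := Finsupp.sum_single_index (by simp)
    have h1 : Finsupp.single p c = c • Finsupp.single p (1 : ℤ) := by simp
    rw [h, h1]
    simp only [Finsupp.smul_apply, smul_eq_mul]
    linear_combination c * elemD0_apply_sub p a b

/-- The difference equation in `b` satisfied by `D₁ μ`. -/
lemma demD1_apply_sub (mu : (ℤ × ℤ) →₀ ℤ) (a b : ℤ) :
    demD1 mu (a, b) - demD1 mu (a, b - 1) = mu (a, b) - mu (a, 2 * a + 1 - b) := by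
  induction mu using Finsupp.induction_linear with
  | zero => simp [demD1]
  | add f g hf hg =>
    have h : demD1 (f + g) = demD1 f + demD1 g :=
      Finsupp.sum_add_index' (by simp) (fun _ _ _ => add_smul _ _ _)
    simp only [h, Finsupp.add_apply]
    linarith
  | single p c =>
    have h : demD1 (Finsupp.single p c) = c • elemD1 p := Finsupp.sum_single_index (by simp)
    have h1 : Finsupp.single p c = c • Finsupp.single p (1 : ℤ) := by simp
    rw [h, h1]
    simp only [Finsupp.smul_apply, smul_eq_mul]
    linear_combination c * elemD1_apply_sub p a b

lemma eq_zero_of_sub_eq_zero {h : ℤ → ℤ} (hh : ∀ x, h x = h (x - 1))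
    (hz : ∃ x, h x = 0) (x : ℤ) : h x = 0 := by
  obtain ⟨y, hy⟩ := hz
  have key : ∀ z, h (y + z) = 0 := by
    intro z
    induction z using Int.induction_on with
    | zero => simpa using hy
    | succ i ih => rw [hh, ← ih]; congr 1; ring
    | pred i ih => rw [← ih, hh (y + -i)]; congr 1; ring
  simpa using key (x - y)

lemma Finsupp.exists_forall_outside_eq_zero (mu : (ℤ × ℤ) →₀ ℤ) :
    ∃ B : ℤ, ∀ p : ℤ × ℤ, p.1 < -B ∨ B < p.2 → mu p = 0 := by
  refine ⟨∑ p ∈ mu.support, (|p.1| + |p.2|), fun p hp => ?_⟩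
  by_contra hne
  have h : |p.1| + |p.2| ≤ ∑ p ∈ mu.support, (|p.1| + |p.2|) :=
    Finset.single_le_sum (f := fun p : ℤ × ℤ => |p.1| + |p.2|) (fun _ _ => by positivity)
      (Finsupp.mem_support_iff.mpr hne)
  have := neg_abs_le p.1
  have := le_abs_self p.2
  have := abs_nonneg p.1
  have := abs_nonneg p.2
  omega

/-- Uniqueness of solutions of the difference equation for `D₀` that vanish near `-∞`. -/
lemma demD0_apply_eq (mu : (ℤ × ℤ) →₀ ℤ) (g : ℤ → ℤ → ℤ)
    (hg : ∀ a b, g a b - g (a - 1) b = mu (a, b) - mu (2 * b + 2 - a, b))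
    (hz : ∀ b, ∃ A, ∀ a < A, g a b = 0) (a b : ℤ) : demD0 mu (a, b) = g a b := by
  refine sub_eq_zero.mp (eq_zero_of_sub_eq_zero (h := fun x => demD0 mu (x, b) - g x b)
    (fun x => ?_) ?_ a)
  · linear_combination demD0_apply_sub mu x b - hg x b
  · obtain ⟨A, hA⟩ := hz b
    obtain ⟨B, hB⟩ := (demD0 mu).exists_forall_outside_eq_zero
    refine ⟨min A (-B) - 1, ?_⟩
    rw [hA _ (by omega), hB _ (Or.inl (by simp only; omega)), sub_zero]

/-- Uniqueness of solutions of the difference equation for `D₁` that vanish near `+∞`. -/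
lemma demD1_apply_eq (mu : (ℤ × ℤ) →₀ ℤ) (g : ℤ → ℤ → ℤ)
    (hg : ∀ a b, g a b - g a (b - 1) = mu (a, b) - mu (a, 2 * a + 1 - b))
    (hz : ∀ a, ∃ A, ∀ b > A, g a b = 0) (a b : ℤ) : demD1 mu (a, b) = g a b := by
  refine sub_eq_zero.mp (eq_zero_of_sub_eq_zero (h := fun x => demD1 mu (a, x) - g a x)
    (fun x => ?_) ?_ b)
  · linear_combination demD1_apply_sub mu a x - hg a x
  · obtain ⟨A, hA⟩ := hz a
    obtain ⟨B, hB⟩ := (demD1 mu).exists_forall_outside_eq_zero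
    refine ⟨max A B + 1, ?_⟩
    rw [hA _ (by omega), hB _ (Or.inr (by simp only; omega)), sub_zero]

/-- The multiset of pairs `(r, c)` in which `(r, c)` occurs as often as the coefficient of `q ^ c`
in the Gaussian binomial coefficient `[N choose r]`. -/
def gaussPairs : ℕ → Multiset (ℤ × ℤ)
  | 0 => {(0, 0)}
  | N + 1 => (gaussPairs N).map (fun p => (p.1 + 1, p.2)) +
      (gaussPairs N).map (fun p => (p.1, p.2 + p.1))

/-- The coefficient of `q ^ c` in the Gaussian binomial coefficient `[N choose r]`. -/
def gaussCoeff (N : ℕ) (r c : ℤ) : ℤ := (gaussPairs N).count (r, c)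

lemma gaussCoeff_zero (r c : ℤ) : gaussCoeff 0 r c = if r = 0 ∧ c = 0 then 1 else 0 := by
  simp [gaussCoeff, gaussPairs, Multiset.count_singleton]

/-- The first `q`-Pascal identity. -/
lemma gaussCoeff_succ (N : ℕ) (r c : ℤ) :
    gaussCoeff (N + 1) r c = gaussCoeff N (r - 1) c + gaussCoeff N r (c - r) := by
  have h1 : ((gaussPairs N).map (fun p => (p.1 + 1, p.2))).count (r, c) =
      (gaussPairs N).count (r - 1, c) := by
    rw [← Multiset.count_map_eq_count' (fun p : ℤ × ℤ => (p.1 + 1, p.2)) _ _ (r - 1, c)]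
    · simp only [sub_add_cancel]
    · rintro ⟨x, y⟩ ⟨z, w⟩ h
      simpa using h
  have h2 : ((gaussPairs N).map (fun p => (p.1, p.2 + p.1))).count (r, c) =
      (gaussPairs N).count (r, c - r) := by
    rw [← Multiset.count_map_eq_count' (fun p : ℤ × ℤ => (p.1, p.2 + p.1)) _ _ (r, c - r)]
    · simp only [sub_add_cancel]
    · rintro ⟨x, y⟩ ⟨z, w⟩ h
      simp only [Prod.mk.injEq] at h ⊢
      omega
  simp only [gaussCoeff, gaussPairs, Multiset.count_add, h1, h2, Nat.cast_add]

lemma gaussCoeff_of_neg (N : ℕ) (r c : ℤ) (hr : r < 0) : gaussCoeff N r c = 0 := by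
  induction N generalizing r c with
  | zero => rw [gaussCoeff_zero, if_neg (by omega)]
  | succ N ih => rw [gaussCoeff_succ, ih _ _ (by omega), ih _ _ hr, add_zero]

/-- The second `q`-Pascal identity. -/
lemma gaussCoeff_succ' (N : ℕ) (r c : ℤ) :
    gaussCoeff (N + 1) r c = gaussCoeff N (r - 1) (c - (N + 1 - r)) + gaussCoeff N r c := by
  induction N generalizing r c with
  | zero =>
    simp only [gaussCoeff_succ, gaussCoeff_zero]
    push_cast
    split_ifs <;> omega
  | succ N ih =>
    rw [gaussCoeff_succ, ih (r - 1) c, ih r (c - r), gaussCoeff_succ N (r - 1),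
      gaussCoeff_succ N r]
    push_cast
    ring_nf

lemma gaussCoeff_symm (N : ℕ) (r c : ℤ) : gaussCoeff N r c = gaussCoeff N (N - r) c := by
  induction N generalizing r c with
  | zero =>
    simp only [gaussCoeff_zero]
    push_cast
    split_ifs <;> omega
  | succ N ih =>
    rw [gaussCoeff_succ, gaussCoeff_succ', ih (r - 1), ih r]
    push_cast
    ring_nf

/-- The weight multiplicities of level-one Demazure modules are coefficients of Gaussian
binomial coefficients. -/
lemma demMu_apply (k : ℕ) :
    (∀ a b : ℤ, demMu (2 * k) (a, b) = gaussCoeff (2 * k) (k + (a - b)) (a - (a - b) ^ 2)) ∧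
    ∀ a b : ℤ, demMu (2 * k + 1) (a, b) =
      gaussCoeff (2 * k + 1) (k + (a - b)) (a - (a - b) ^ 2) := by
  have odd_of_even : ∀ k : ℕ,
      (∀ a b : ℤ, demMu (2 * k) (a, b) = gaussCoeff (2 * k) (k + (a - b)) (a - (a - b) ^ 2)) →
      ∀ a b : ℤ, demMu (2 * k + 1) (a, b) =
        gaussCoeff (2 * k + 1) (k + (a - b)) (a - (a - b) ^ 2) := by
    intro k h
    rw [demMu, if_pos (by simp)]
    refine demD0_apply_eq _
      (fun a b => gaussCoeff (2 * k + 1) (k + (a - b)) (a - (a - b) ^ 2)) (fun a b => ?_)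
      (fun b => ⟨b - k, fun a ha => gaussCoeff_of_neg _ _ _ (by omega)⟩)
    rw [h, h, gaussCoeff_symm (2 * k) (k + (2 * b + 2 - a - b)), gaussCoeff_succ',
      gaussCoeff_succ]
    push_cast
    ring_nf
  have even_of_odd : ∀ k : ℕ,
      (∀ a b : ℤ, demMu (2 * k + 1) (a, b) =
        gaussCoeff (2 * k + 1) (k + (a - b)) (a - (a - b) ^ 2)) →
      ∀ a b : ℤ, demMu (2 * (k + 1)) (a, b) =
        gaussCoeff (2 * (k + 1)) ((k + 1 : ℕ) + (a - b)) (a - (a - b) ^ 2) := by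
    intro k h
    rw [show 2 * (k + 1) = 2 * k + 1 + 1 by ring, demMu, if_neg (by simp)]
    refine demD1_apply_eq _
      (fun a b => gaussCoeff (2 * k + 1 + 1) ((k + 1 : ℕ) + (a - b)) (a - (a - b) ^ 2))
      (fun a b => ?_)
      (fun a => ⟨a + k + 1, fun b hb => gaussCoeff_of_neg _ _ _ (by push_cast; omega)⟩)
    rw [h, h, gaussCoeff_symm (2 * k + 1) (k + (a - (2 * a + 1 - b))),
      gaussCoeff_succ (2 * k + 1), gaussCoeff_succ' (2 * k + 1) _ (a - (a - (b - 1)) ^ 2)]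
    push_cast
    ring_nf
  induction k with
  | zero =>
    have h0 : ∀ a b : ℤ, demMu (2 * 0) (a, b) =
        gaussCoeff (2 * 0) ((0 : ℕ) + (a - b)) (a - (a - b) ^ 2) := by
      intro a b
      simp only [mul_zero, demMu, gaussCoeff_zero, Finsupp.single_apply, Prod.mk.injEq,
        Nat.cast_zero, zero_add]
      refine if_congr ⟨?_, ?_⟩ rfl rfl
      · rintro ⟨rfl, rfl⟩
        simp
      · rintro ⟨h1, h2⟩
        rw [h1] at h2
        omega
    exact ⟨h0, odd_of_even 0 h0⟩
  | succ k ih => exact ⟨even_of_odd k ih.2, odd_of_even _ (even_of_odd k ih.2)⟩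

/-- Average of `F` over `gaussPairs N`, which has `2 ^ N` elements. -/
noncomputable def gaussAvg (N : ℕ) (F : ℤ × ℤ → ℝ) : ℝ := ((gaussPairs N).map F).sum / 2 ^ N

lemma gaussAvg_succ (N : ℕ) (F : ℤ × ℤ → ℝ) :
    gaussAvg (N + 1) F =
      (gaussAvg N (fun p => F (p.1 + 1, p.2)) + gaussAvg N (fun p => F (p.1, p.2 + p.1))) / 2 := by
  simp only [gaussAvg, gaussPairs, Multiset.map_add, Multiset.sum_add, Multiset.map_map,
    Function.comp_def]
  field_simp
  ring

lemma gaussAvg_add (N : ℕ) (F G : ℤ × ℤ → ℝ) :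
    gaussAvg N (fun p => F p + G p) = gaussAvg N F + gaussAvg N G := by
  simp only [gaussAvg, Multiset.sum_map_add, add_div]

lemma gaussAvg_const_mul (N : ℕ) (t : ℝ) (F : ℤ × ℤ → ℝ) :
    gaussAvg N (fun p => t * F p) = t * gaussAvg N F := by
  simp only [gaussAvg, Multiset.sum_map_mul_left, mul_div_assoc]

lemma gaussAvg_one (N : ℕ) : gaussAvg N (fun _ => 1) = 1 := by
  induction N with
  | zero => simp [gaussAvg, gaussPairs]
  | succ N ih => rw [gaussAvg_succ, ih]; norm_num

lemma gaussAvg_const (N : ℕ) (t : ℝ) : gaussAvg N (fun _ => t) = t := by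
  simpa [gaussAvg_one] using gaussAvg_const_mul N t (fun _ => 1)

lemma gaussAvg_mono (N : ℕ) {F G : ℤ × ℤ → ℝ} (h : ∀ p, F p ≤ G p) :
    gaussAvg N F ≤ gaussAvg N G := by
  unfold gaussAvg
  gcongr
  exact Multiset.sum_map_le_sum_map _ _ fun p _ => h p

lemma gaussAvg_fst (N : ℕ) : gaussAvg N (fun p => (p.1 : ℝ)) = N / 2 := by
  induction N with
  | zero => simp [gaussAvg, gaussPairs]
  | succ N ih =>
    rw [gaussAvg_succ]
    push_cast
    rw [gaussAvg_add, gaussAvg_const, ih]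
    ring

lemma gaussAvg_fst_sq (N : ℕ) : gaussAvg N (fun p => (p.1 : ℝ) ^ 2) = (N ^ 2 + N) / 4 := by
  induction N with
  | zero => simp [gaussAvg, gaussPairs]
  | succ N ih =>
    have h : ∀ x : ℝ, (x + 1) ^ 2 = x ^ 2 + (2 * x + 1) := fun x => by ring
    rw [gaussAvg_succ]
    push_cast
    simp only [h, gaussAvg_add, gaussAvg_const_mul, gaussAvg_const, gaussAvg_fst, ih]
    ring

lemma gaussAvg_snd (N : ℕ) : gaussAvg N (fun p => (p.2 : ℝ)) = N * (N - 1) / 8 := by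
  induction N with
  | zero => simp [gaussAvg, gaussPairs]
  | succ N ih =>
    rw [gaussAvg_succ]
    push_cast
    simp only [gaussAvg_add, gaussAvg_fst, ih]
    ring

lemma gaussAvg_snd_mul_fst (N : ℕ) :
    gaussAvg N (fun p => (p.2 : ℝ) * p.1) = N ^ 2 * (N - 1) / 16 := by
  induction N with
  | zero => simp [gaussAvg, gaussPairs]
  | succ N ih =>
    have h1 : ∀ x y : ℝ, y * (x + 1) = y * x + y := fun x y => by ring
    have h2 : ∀ x y : ℝ, (y + x) * x = y * x + x ^ 2 := fun x y => by ring
    rw [gaussAvg_succ]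
    push_cast
    simp only [h1, h2, gaussAvg_add, gaussAvg_fst_sq, gaussAvg_snd, ih]
    ring

lemma gaussAvg_snd_sq (N : ℕ) :
    gaussAvg N (fun p => (p.2 : ℝ) ^ 2) = N * (N - 1) * (3 * N ^ 2 + N + 10) / 192 := by
  induction N with
  | zero => simp [gaussAvg, gaussPairs]
  | succ N ih =>
    have h : ∀ x y : ℝ, (y + x) ^ 2 = y ^ 2 + (2 * (y * x) + x ^ 2) := fun x y => by ring
    rw [gaussAvg_succ]
    push_cast
    simp only [h, gaussAvg_add, gaussAvg_const_mul, gaussAvg_fst_sq, gaussAvg_snd_mul_fst, ih]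
    ring

/-- The rescaled pairs concentrate in mean square at `(1/2, 0)`. -/
lemma gaussAvg_sq_dist_le (k : ℕ) (hk : 0 < k) :
    gaussAvg (2 * k) (fun p => ((p.2 : ℝ) / k ^ 2 - 1 / 2) ^ 2 + (((p.1 : ℝ) - k) / k) ^ 2) ≤
      2 / k := by
  have hk' : (1 : ℝ) ≤ k := by exact_mod_cast hk
  have h : ∀ x y : ℝ, (y / k ^ 2 - 1 / 2) ^ 2 + ((x - k) / k) ^ 2 =
      (1 / k ^ 4) * y ^ 2 + ((-1 / k ^ 2) * y + ((1 / k ^ 2) * x ^ 2 + ((-2 / k) * x + 5 / 4))) := by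
    intro x y
    field_simp
    ring
  simp only [h, gaussAvg_add, gaussAvg_const_mul, gaussAvg_const, gaussAvg_fst, gaussAvg_fst_sq,
    gaussAvg_snd, gaussAvg_snd_sq]
  push_cast
  rw [← sub_nonneg]
  have e : ∀ x : ℝ, x ≠ 0 → 2 / x -
      (1 / x ^ 4 * (2 * x * (2 * x - 1) * (3 * (2 * x) ^ 2 + 2 * x + 10) / 192) +
      (-1 / x ^ 2 * (2 * x * (2 * x - 1) / 8) + (1 / x ^ 2 * (((2 * x) ^ 2 + 2 * x) / 4) +
      (-2 / x * (2 * x / 2) + 5 / 4)))) = (64 * x ^ 2 - 9 * x + 5) / (48 * x ^ 3) := by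
    intro x hx
    field_simp
    ring
  rw [e _ (by positivity)]
  apply div_nonneg _ (by positivity)
  nlinarith

/-- Integrals against `demNu k` are averages over `gaussPairs (2 * k)`. -/
lemma integral_demNu (k : ℕ) (f : ℝ × ℝ → ℝ) :
    ∫ x, f x ∂(demNu k) = gaussAvg (2 * k) (fun p =>
      f ((p.2 : ℝ) / k ^ 2 + (((p.1 : ℝ) - k) / k) ^ 2, ((p.1 : ℝ) - k) / k)) := by
  set T : ℤ × ℤ → ℤ × ℤ := fun p => (p.2 + (p.1 - k) ^ 2, p.2 + (p.1 - k) ^ 2 - (p.1 - k)) with hT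
  have hTinj : Function.Injective T := by
    rintro ⟨x, y⟩ ⟨z, w⟩ h
    simp only [hT, Prod.mk.injEq] at h
    obtain ⟨h1, h2⟩ := h
    have hxz : x = z := by linarith
    subst hxz
    simpa using h1
  have hmu : ∀ p, demMu (2 * k) p = ((gaussPairs (2 * k)).map T).count p := by
    rintro ⟨a, b⟩
    rw [(demMu_apply k).1, gaussCoeff, ← Multiset.count_map_eq_count' T _ hTinj]
    congr 2
    simp only [hT, Prod.mk.injEq]
    constructor <;> ring
  have hsupp : (demMu (2 * k)).support = ((gaussPairs (2 * k)).map T).toFinset := by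
    ext p
    rw [Finsupp.mem_support_iff, hmu, Multiset.mem_toFinset, Nat.cast_ne_zero,
      Multiset.count_ne_zero]
  rw [demNu, MeasureTheory.integral_smul_measure, MeasureTheory.integral_finsetSum_measure
    (fun p _ => (MeasureTheory.integrable_dirac (by simp)).smul_measure ENNReal.ofReal_ne_top)]
  simp only [MeasureTheory.integral_smul_measure, MeasureTheory.integral_dirac, hmu, hsupp]
  have hc : ∀ n : ℕ, (ENNReal.ofReal (((n : ℤ) : ℝ))).toReal = n := by
    intro n
    rw [ENNReal.toReal_ofReal] <;> simp
  simp only [hc]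
  have hsum := Finset.sum_multiset_map_count ((gaussPairs (2 * k)).map T)
    (fun p : ℤ × ℤ => f ((p.1 : ℝ) / (k : ℝ) ^ 2, ((p.1 : ℝ) - (p.2 : ℝ)) / (k : ℝ)))
  simp only [nsmul_eq_mul] at hsum
  simp only [smul_eq_mul]
  rw [← hsum, Multiset.map_map, gaussAvg, pow_mul]
  simp only [Function.comp_def, hT, ENNReal.toReal_inv, ENNReal.toReal_pow, ENNReal.toReal_ofNat]
  rw [div_eq_inv_mul]
  push_cast
  norm_num
  congr 2
  ext p
  congr 2
  ring

open MeasureTheory Filter in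
/-- Weak law of large numbers for level-1 Demazure modules: the rescaled normalized weight
distributions of `V_{(s₁s₀)^k}(Λ₀)` converge weakly to the Dirac measure at `(1/2, 0)`. -/
theorem demazure_weak_law_of_large_numbers
    (f : ℝ × ℝ → ℝ) (hf : Continuous f) (hbdd : ∃ C : ℝ, ∀ x, |f x| ≤ C) :
    Tendsto (fun k => ∫ x, f x ∂(demNu k)) atTop (nhds (f (1 / 2, 0))) := by
  obtain ⟨C, hC⟩ := hbdd
  have hC0 : 0 ≤ C := (abs_nonneg _).trans (hC 0)
  set g : ℝ × ℝ → ℝ := fun z => f (z.1 + z.2 ^ 2, z.2) with hg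
  have hgc : Continuous g := by fun_prop
  have hg0 : g (1 / 2, 0) = f (1 / 2, 0) := by simp [hg]
  rw [Metric.tendsto_atTop]
  intro ε hε
  obtain ⟨δ, hδ, hd⟩ := Metric.continuous_iff.mp hgc (1 / 2, 0) (ε / 2) (half_pos hε)
  have hpt : ∀ x y : ℝ, |g (x, y) - f (1 / 2, 0)| ≤
      ε / 2 + 2 * C / δ ^ 2 * ((x - 1 / 2) ^ 2 + y ^ 2) := by
    intro x y
    have hnn : 0 ≤ 2 * C / δ ^ 2 * ((x - 1 / 2) ^ 2 + y ^ 2) := by positivity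
    by_cases h : dist (x, y) ((1 / 2 : ℝ), (0 : ℝ)) < δ
    · have := hd (x, y) h
      rw [Real.dist_eq, hg0] at this
      linarith
    · rw [Prod.dist_eq, not_lt, le_max_iff] at h
      simp only [Real.dist_eq, sub_zero] at h
      have hsq : δ ^ 2 ≤ (x - 1 / 2) ^ 2 + y ^ 2 := by
        rcases h with h | h
        · have := pow_le_pow_left₀ hδ.le h 2
          rw [sq_abs] at this
          linarith [sq_nonneg y]
        · have := pow_le_pow_left₀ hδ.le h 2
          rw [sq_abs] at this
          linarith [sq_nonneg (x - 1 / 2)]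
      have h1 : 2 * C ≤ 2 * C / δ ^ 2 * ((x - 1 / 2) ^ 2 + y ^ 2) := by
        rw [div_mul_eq_mul_div, le_div_iff₀ (by positivity)]
        gcongr
      have h2 : |g (x, y) - f (1 / 2, 0)| ≤ C + C :=
        (abs_sub _ _).trans (add_le_add (hC _) (hC _))
      linarith
  obtain ⟨K, hK⟩ := exists_nat_gt (2 * C / δ ^ 2 * 2 / (ε / 2))
  refine ⟨K + 1, fun k hk => ?_⟩
  have hk0 : 0 < k := by omega
  have hkR : (0 : ℝ) < k := by exact_mod_cast hk0
  have hKk : 2 * C / δ ^ 2 * 2 / (ε / 2) < k := hK.trans (by exact_mod_cast hk)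
  have hsmall : 2 * C / δ ^ 2 * (2 / k) < ε / 2 := by
    rw [div_lt_iff₀ (half_pos hε)] at hKk
    rw [← mul_div_assoc, div_lt_iff₀ hkR]
    linarith
  set D : ℤ × ℤ → ℝ := fun p => ((p.2 : ℝ) / k ^ 2 - 1 / 2) ^ 2 + (((p.1 : ℝ) - k) / k) ^ 2
  set G : ℤ × ℤ → ℝ := fun p => g ((p.2 : ℝ) / k ^ 2, ((p.1 : ℝ) - k) / k) with hG
  have hD : gaussAvg (2 * k) D ≤ 2 / k := gaussAvg_sq_dist_le k hk0
  have hbound : 2 * C / δ ^ 2 * gaussAvg (2 * k) D ≤ 2 * C / δ ^ 2 * (2 / k) := by gcongr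
  have hupper : gaussAvg (2 * k) G ≤
      gaussAvg (2 * k) (fun p => f (1 / 2, 0) + ε / 2 + 2 * C / δ ^ 2 * D p) :=
    gaussAvg_mono _ fun p => by
      have := (abs_le.mp (hpt ((p.2 : ℝ) / k ^ 2) (((p.1 : ℝ) - k) / k))).2
      simp only [hG, D]
      linarith
  have hlower : gaussAvg (2 * k) (fun p => f (1 / 2, 0) - ε / 2 + -(2 * C / δ ^ 2) * D p) ≤
      gaussAvg (2 * k) G :=
    gaussAvg_mono _ fun p => by
      have := (abs_le.mp (hpt ((p.2 : ℝ) / k ^ 2) (((p.1 : ℝ) - k) / k))).1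
      simp only [hG, D]
      linarith
  rw [gaussAvg_add, gaussAvg_const, gaussAvg_const_mul] at hupper hlower
  rw [integral_demNu, Real.dist_eq, abs_lt]
  change _ < gaussAvg (2 * k) G - _ ∧ gaussAvg (2 * k) G - _ < _
  constructor <;> linarith
end
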